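/- Let N = (G, u, W) be a network in which the tuple u = (u_1,…,u_{2n}) is G-compatible with the ordered vertex set W, and let I ⊆ [2n] be a subset of even cardinality. Then Q_I(N) = pf_{I,Ī}(A(N)). -/

import Mathlib

open scoped Classical
noncomputable section

/-- The crossing number of a matching `π` (pairs written `(i,j)` with `i < j`): the number of
pairs `{i,j}, {k,l}` of `π` with `i < k < j < l`. -/
def crossNum (π : Finset (ℕ × ℕ)) : ℕ :=
  ((π ×ˢ π).filter fun pq => pq.1.1 < pq.2.1 ∧ pq.2.1 < pq.1.2 ∧ pq.1.2 < pq.2.2).card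

/-- `π` is a perfect matching of the finite set `I`: a set of pairs `(i,j)`, `i < j`, with all
endpoints in `I`, pairwise disjoint, covering every element of `I`. -/
def IsPM (I : Finset ℕ) (π : Finset (ℕ × ℕ)) : Prop :=
  (∀ p ∈ π, p.1 ∈ I ∧ p.2 ∈ I ∧ p.1 < p.2) ∧
  (∀ p ∈ π, ∀ q ∈ π, p ≠ q → p.1 ≠ q.1 ∧ p.1 ≠ q.2 ∧ p.2 ≠ q.1 ∧ p.2 ≠ q.2) ∧
  (∀ k ∈ I, ∃ p ∈ π, k = p.1 ∨ k = p.2)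

/-- `pf_I(A)`: the Pfaffian of the submatrix of `A` on rows and columns indexed by `I`,
`pf_I(A) = Σ_π ε(π) Π_{(i,j) ∈ π} a_{ij}` over perfect matchings `π` of `I`
(equal to `1` when `I = ∅`). -/
def pfSub {R : Type*} [CommRing R] (A : ℕ → ℕ → R) (I : Finset ℕ) : R :=
  ∑ π ∈ (I ×ˢ I).powerset.filter (fun π => IsPM I π),
    (-1 : R) ^ crossNum π * ∏ p ∈ π, A p.1 p.2

variable {V : Type*} {R : Type*} [CommRing R]

/-- The vertex list of a path, encoded as a head vertex together with the list of
subsequent vertices. -/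
def pverts (p : V × List V) : List V := p.1 :: p.2

/-- `p` is a directed path of the digraph `E`: consecutive vertices are joined by edges. -/
def IsPathOf (E : V → V → Prop) (p : V × List V) : Prop := List.Chain E p.1 p.2

/-- `p` is a directed path of `E` from `x` to `y`. -/
def PathFromTo (E : V → V → Prop) (p : V × List V) (x y : V) : Prop :=
  IsPathOf E p ∧ p.1 = x ∧ (pverts p).getLast (List.cons_ne_nil _ _) = y

/-- Two paths intersect if they share a common vertex. -/
def Intersects (p q : V × List V) : Prop := ∃ v, v ∈ pverts p ∧ v ∈ pverts q

/-- The weight of a path: the product of the weights of its edges. -/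
def pathWeight (w : V → V → R) (p : V × List V) : R :=
  (((pverts p).zip p.2).map fun e => w e.1 e.2).prod

/-- `A(N)`: the matrix whose `(i,j)` entry is the sum of `w(p)·w(q)` over all pairs of
non-intersecting paths `p` from `u_i` to `W` and `q` from `u_j` to `W`. -/
def ANet (E : V → V → Prop) (w : V → V → R) (u : ℕ → V) (W : List V) (i j : ℕ) : R :=
  ∑ᶠ pq ∈ {pq : (V × List V) × (V × List V) |
      (∃ y ∈ W, PathFromTo E pq.1 (u i) y) ∧ (∃ y ∈ W, PathFromTo E pq.2 (u j) y) ∧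
      ¬Intersects pq.1 pq.2},
    pathWeight w pq.1 * pathWeight w pq.2

/-- `P_I(N)`: the set of `2n`-tuples of paths `(p_1,…,p_{2n})`, with `p_i` running from `u_i`
to some vertex of `W`, such that `p_i` and `p_j` do not intersect whenever `i,j` are both in
`I` or both in `Ī = [2n] ∖ I`. -/
def PISet (E : V → V → Prop) (u : ℕ → V) (W : List V) (n : ℕ) (I : Finset ℕ) :
    Set (Fin (2 * n) → V × List V) :=
  {p | (∀ i, ∃ y ∈ W, PathFromTo E (p i) (u (i.1 + 1)) y) ∧
       ∀ i j, i ≠ j → ((i.1 + 1 ∈ I) ↔ (j.1 + 1 ∈ I)) → ¬Intersects (p i) (p j)}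

/-- `Q_I(N)`: the weight sum over the `I`-compatible path families `P_I(N)`. -/
def QI (E : V → V → Prop) (w : V → V → R) (u : ℕ → V) (W : List V) (n : ℕ)
    (I : Finset ℕ) : R :=
  ∑ᶠ p ∈ PISet E u W n I, ∏ i, pathWeight w (p i)


/-! ### Signs of matchings -/

def mcr (p q : ℕ × ℕ) : Prop := p.1 < q.1 ∧ q.1 < p.2 ∧ p.2 < q.2

def msg (p q : ℕ × ℕ) : ℤ := if mcr p q then -1 else 1

def msgn (π : Finset (ℕ × ℕ)) : ℤ := (-1) ^ crossNum π

def ms2 (p q : ℕ × ℕ) : ℤ := msg p q * msg q p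

lemma msgn_eq (π : Finset (ℕ × ℕ)) : msgn π = ∏ p ∈ π, ∏ q ∈ π, msg p q := by
  rw [← Finset.prod_product' (f := fun p q => msg p q)]
  unfold msgn crossNum msg
  rw [Finset.prod_ite]
  simp only [Finset.prod_const, one_pow, mul_one]
  congr!

lemma msgn_insert (e : ℕ × ℕ) (π : Finset (ℕ × ℕ)) (he : e ∉ π) :
    msgn (insert e π) = msgn π * ∏ q ∈ π, ms2 e q := by
  have h0 : msg e e = 1 := by simp [msg, mcr]
  simp only [msgn_eq, ms2, Finset.prod_insert he, Finset.prod_mul_distrib, h0]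
  ring

def msrt (a b : ℕ) : ℕ × ℕ := (min a b, max a b)

def mchi (q : ℕ × ℕ) (x : ℕ) : ℤ := if q.1 < x ∧ x < q.2 then -1 else 1

lemma ms2_srt (x y : ℕ) (q : ℕ × ℕ) (hq : q.1 < q.2) (hxy : x ≠ y)
    (h1 : x ≠ q.1) (h2 : x ≠ q.2) (h3 : y ≠ q.1) (h4 : y ≠ q.2) :
    ms2 (msrt x y) q = mchi q x * mchi q y := by
  obtain ⟨c, d⟩ := q
  simp only [ms2, msg, mcr, mchi, msrt] at *
  rcases lt_or_gt_of_ne hxy with h | h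
  · simp only [min_eq_left h.le, max_eq_right h.le]
    split_ifs <;> first | rfl | omega
  · simp only [min_eq_right h.le, max_eq_left h.le]
    split_ifs <;> first | rfl | omega

lemma ms2_toggle (i j a b : ℕ) (hij : i < j) (hab : a ≠ b)
    (ha : a < i ∨ j < a) (hb : b < i ∨ j < b) :
    ms2 (msrt j a) (msrt i b) = - ms2 (msrt i a) (msrt j b) := by
  have e1 : ∀ x y : ℕ, x < y → msrt x y = (x, y) := fun x y h => by
    simp [msrt, h.le]
  have e2 : ∀ x y : ℕ, y < x → msrt x y = (y, x) := fun x y h => by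
    simp [msrt, h.le]
  rcases ha with ha | ha <;> rcases hb with hb | hb
  · rw [e2 j a (by omega), e2 i b (by omega), e2 i a (by omega), e2 j b (by omega)]
    simp only [ms2, msg, mcr]
    grind
  · rw [e2 j a (by omega), e1 i b (by omega), e2 i a (by omega), e1 j b (by omega)]
    simp only [ms2, msg, mcr]
    grind
  · rw [e1 j a (by omega), e2 i b (by omega), e1 i a (by omega), e2 j b (by omega)]
    simp only [ms2, msg, mcr]
    grind
  · rw [e1 j a (by omega), e1 i b (by omega), e1 i a (by omega), e1 j b (by omega)]
    simp only [ms2, msg, mcr]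
    grind

def mact (i j : ℕ) (e : ℕ × ℕ) : ℕ × ℕ := msrt (Equiv.swap i j e.1) (Equiv.swap i j e.2)

lemma msrt_comm (a b : ℕ) : msrt a b = msrt b a := by
  simp [msrt, min_comm, max_comm]

lemma msrt_of_lt (e : ℕ × ℕ) (h : e.1 < e.2) : msrt e.1 e.2 = e := by
  simp [msrt, h.le]

lemma mact_srt (i j a b : ℕ) :
    mact i j (msrt a b) = msrt (Equiv.swap i j a) (Equiv.swap i j b) := by
  rcases le_total a b with h | h
  · simp [mact, msrt, h]
  · simp [mact, msrt, h, min_comm, max_comm]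

lemma mact_mact (i j : ℕ) (e : ℕ × ℕ) (h : e.1 < e.2) : mact i j (mact i j e) = e := by
  conv_lhs => rw [show mact i j e = msrt _ _ from rfl, mact_srt]
  simp [msrt_of_lt e h]

lemma mact_lt (i j : ℕ) (e : ℕ × ℕ) (h : e.1 < e.2) : (mact i j e).1 < (mact i j e).2 := by
  have : Equiv.swap i j e.1 ≠ Equiv.swap i j e.2 := by
    intro hh; exact h.ne ((Equiv.swap i j).injective hh)
  simp only [mact, msrt]
  exact min_lt_max.2 this

lemma mact_mem (i j k : ℕ) (e : ℕ × ℕ) :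
    (k = (mact i j e).1 ∨ k = (mact i j e).2) ↔
      (Equiv.swap i j k = e.1 ∨ Equiv.swap i j k = e.2) := by
  have h : ∀ x, Equiv.swap i j k = x ↔ k = Equiv.swap i j x := fun x => by
    rw [Equiv.swap_apply_eq_iff]
  rw [h, h]
  simp only [mact, msrt]
  rcases le_total (Equiv.swap i j e.1) (Equiv.swap i j e.2) with h | h
  · simp [h]
  · simp [h, or_comm]

lemma mact_IsPM (i j : ℕ) (J : Finset ℕ) (hi : i ∈ J) (hj : j ∈ J) (π : Finset (ℕ × ℕ))
    (h : IsPM J π) : IsPM J (π.image (mact i j)) := by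
  have hJ : ∀ k, Equiv.swap i j k ∈ J ↔ k ∈ J := by
    intro k
    by_cases h1 : k = i
    · subst h1; simp [hi, hj]
    by_cases h2 : k = j
    · subst h2; simp [hi, hj]
    rw [Equiv.swap_apply_of_ne_of_ne h1 h2]
  obtain ⟨h1, h2, h3⟩ := h
  refine ⟨?_, ?_, ?_⟩
  · intro p hp
    obtain ⟨e, he, rfl⟩ := Finset.mem_image.1 hp
    obtain ⟨ha, hb, hc⟩ := h1 e he
    have m1 := (mact_mem i j (mact i j e).1 e).1 (Or.inl rfl)
    have m2 := (mact_mem i j (mact i j e).2 e).1 (Or.inr rfl)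
    refine ⟨?_, ?_, mact_lt i j e hc⟩
    · rw [← hJ]; rcases m1 with m | m <;> rw [m] <;> assumption
    · rw [← hJ]; rcases m2 with m | m <;> rw [m] <;> assumption
  · intro p hp q hq hpq
    obtain ⟨e, he, rfl⟩ := Finset.mem_image.1 hp
    obtain ⟨f, hf, rfl⟩ := Finset.mem_image.1 hq
    have hef : e ≠ f := fun h => hpq (by rw [h])
    have key : ∀ k, (k = (mact i j e).1 ∨ k = (mact i j e).2) →
        (k = (mact i j f).1 ∨ k = (mact i j f).2) → False := by
      intro k ha hb
      rw [mact_mem] at ha hb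
      have := h2 e he f hf hef
      rcases ha with ha | ha <;> rcases hb with hb | hb <;> rw [ha] at hb <;> simp_all
    refine ⟨fun h => key _ (Or.inl rfl) (Or.inl h), fun h => key _ (Or.inl rfl) (Or.inr h),
      fun h => key _ (Or.inr rfl) (Or.inl h), fun h => key _ (Or.inr rfl) (Or.inr h)⟩
  · intro k hk
    obtain ⟨e, he, hh⟩ := h3 _ ((hJ k).2 hk)
    exact ⟨mact i j e, Finset.mem_image_of_mem _ he, (mact_mem i j k e).2 hh⟩

lemma mact_image_image (i j : ℕ) (J : Finset ℕ) (π : Finset (ℕ × ℕ))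
    (h : IsPM J π) : (π.image (mact i j)).image (mact i j) = π := by
  rw [Finset.image_image]
  conv_rhs => rw [← Finset.image_id (s := π)]
  apply Finset.image_congr
  intro e he
  exact mact_mact i j e (h.1 e he).2.2

lemma exists_srt (k : ℕ) (e : ℕ × ℕ) (h : e.1 < e.2) (hk : k = e.1 ∨ k = e.2) :
    ∃ a, a ≠ k ∧ e = msrt k a ∧ (a = e.1 ∨ a = e.2) := by
  rcases hk with rfl | rfl
  · exact ⟨e.2, h.ne', (msrt_of_lt e h).symm, Or.inr rfl⟩
  · exact ⟨e.1, h.ne, by rw [msrt_comm, msrt_of_lt e h], Or.inl rfl⟩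

lemma msgn_act (i j : ℕ) (J : Finset ℕ) (hi : i ∈ J) (hj : j ∈ J) (hij : i < j)
    (π : Finset (ℕ × ℕ)) (h : IsPM J π)
    (hbad : ∀ e ∈ π, ∀ k, i ≤ k → k ≤ j → e ≠ msrt i k ∧ e ≠ msrt j k) :
    msgn (π.image (mact i j)) = - msgn π := by
  obtain ⟨h1, h2, h3⟩ := h
  obtain ⟨e, he, hie⟩ := h3 i hi
  obtain ⟨f, hf, hjf⟩ := h3 j hj
  obtain ⟨a, hai, hea, ha⟩ := exists_srt i e (h1 e he).2.2 hie
  obtain ⟨b, hbj, hfb, hb⟩ := exists_srt j f (h1 f hf).2.2 hjf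
  have ha' : a < i ∨ j < a := by
    by_contra hc; push Not at hc
    exact (hbad e he a hc.1 hc.2).1 hea
  have hb' : b < i ∨ j < b := by
    by_contra hc; push Not at hc
    exact (hbad f hf b hc.1 hc.2).2 hfb
  have hef : e ≠ f := by
    rintro rfl
    have : j = a := by
      rcases hie with h | h <;> rcases hjf with h' | h' <;> rcases ha with h'' | h'' <;> omega
    omega
  have hdis : ∀ p ∈ π, ∀ q ∈ π, p ≠ q → ∀ k, (k = p.1 ∨ k = p.2) → k ≠ q.1 ∧ k ≠ q.2 := by
    intro p hp q hq hpq k hk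
    have := h2 p hp q hq hpq
    rcases hk with rfl | rfl
    · exact ⟨this.1, this.2.1⟩
    · exact ⟨this.2.2.1, this.2.2.2⟩
  have hab : a ≠ b := by
    have := hdis e he f hf hef a ha
    rcases hb with h | h <;> omega
  set ρ := (π.erase e).erase f with hρ
  have hfρ : f ∉ ρ := by simp [hρ]
  have heρ : e ∉ insert f ρ := by simp [hρ, hef]
  have hπ : π = insert e (insert f ρ) := by
    ext x; simp only [hρ, Finset.mem_insert, Finset.mem_erase]
    grind
  have hρπ : ∀ q ∈ ρ, q ∈ π ∧ q ≠ e ∧ q ≠ f := by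
    intro q hq; simp only [hρ, Finset.mem_erase] at hq; tauto
  have hfix : ∀ q ∈ ρ, mact i j q = q := by
    intro q hq
    obtain ⟨hq, hqe, hqf⟩ := hρπ q hq
    have q1 := hdis e he q hq hqe.symm i hie
    have q2 := hdis f hf q hq hqf.symm j hjf
    rw [mact, Equiv.swap_apply_of_ne_of_ne q1.1.symm q2.1.symm,
      Equiv.swap_apply_of_ne_of_ne q1.2.symm q2.2.symm, msrt_of_lt q (h1 q hq).2.2]
  have hρi : ρ.image (mact i j) = ρ := by
    conv_rhs => rw [← Finset.image_id (s := ρ)]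
    apply Finset.image_congr
    intro q hq; exact hfix q hq
  have hae : mact i j e = msrt j a := by
    rw [hea, mact_srt, Equiv.swap_apply_left, Equiv.swap_apply_of_ne_of_ne] <;> omega
  have haf : mact i j f = msrt i b := by
    rw [hfb, mact_srt, Equiv.swap_apply_right, Equiv.swap_apply_of_ne_of_ne] <;> omega
  have inj : ∀ p ∈ π, ∀ q ∈ π, mact i j p = mact i j q → p = q := by
    intro p hp q hq h
    rw [← mact_mact i j p (h1 p hp).2.2, h, mact_mact i j q (h1 q hq).2.2]
  have hfρ' : mact i j f ∉ ρ := by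
    rw [← hρi]; intro hc
    obtain ⟨q, hq, hqf⟩ := Finset.mem_image.1 hc
    exact (hρπ q hq).2.2 (inj q (hρπ q hq).1 f hf hqf)
  have heρ' : mact i j e ∉ insert (mact i j f) ρ := by
    rw [← hρi, ← Finset.image_insert]; intro hc
    obtain ⟨q, hq, hqf⟩ := Finset.mem_image.1 hc
    have hqπ : q ∈ π := by rw [hπ]; exact Finset.mem_insert_of_mem hq
    have := inj q hqπ e he hqf
    exact heρ (this ▸ hq)
  rw [hπ, Finset.image_insert, Finset.image_insert, hρi, msgn_insert _ _ heρ', msgn_insert _ _ heρ,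
    msgn_insert _ _ hfρ, msgn_insert _ _ hfρ', Finset.prod_insert hfρ, Finset.prod_insert hfρ',
    hae, haf, ms2_toggle i j a b hij hab ha' hb']
  have hprod : (∏ q ∈ ρ, ms2 (msrt i b) q) * (∏ q ∈ ρ, ms2 (msrt j a) q) =
      (∏ q ∈ ρ, ms2 f q) * (∏ q ∈ ρ, ms2 e q) := by
    rw [← Finset.prod_mul_distrib, ← Finset.prod_mul_distrib]
    apply Finset.prod_congr rfl
    intro q hq
    obtain ⟨hq, hqe, hqf⟩ := hρπ q hq
    have q1 := hdis e he q hq hqe.symm i hie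
    have q2 := hdis f hf q hq hqf.symm j hjf
    have q3 := hdis e he q hq hqe.symm a ha
    have q4 := hdis f hf q hq hqf.symm b hb
    have hlt := (h1 q hq).2.2
    rw [hea, hfb, ms2_srt i b q hlt (by omega) q1.1 q1.2 q4.1 q4.2,
      ms2_srt j a q hlt (by omega) q2.1 q2.2 q3.1 q3.2,
      ms2_srt i a q hlt (by omega) q1.1 q1.2 q3.1 q3.2,
      ms2_srt j b q hlt (by omega) q2.1 q2.2 q4.1 q4.2]
    ring
  rw [hea, hfb] at hprod ⊢
  linear_combination (- msgn ρ * ms2 (msrt i a) (msrt j b)) * hprod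

/-! ### Pfaffians -/

def PMs (J : Finset ℕ) : Finset (Finset (ℕ × ℕ)) :=
  (J ×ˢ J).powerset.filter (fun π => IsPM J π)

lemma mem_PMs (J : Finset ℕ) (π : Finset (ℕ × ℕ)) : π ∈ PMs J ↔ IsPM J π := by
  unfold PMs
  rw [Finset.mem_filter, Finset.mem_powerset]
  refine ⟨fun h => h.2, fun h => ⟨?_, h⟩⟩
  intro p hp
  exact Finset.mem_product.2 ⟨(h.1 p hp).1, (h.1 p hp).2.1⟩

lemma pfSub_eq {S : Type*} [CommRing S] (A : ℕ → ℕ → S) (J : Finset ℕ) :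
    pfSub A J = ∑ π ∈ PMs J, (msgn π : S) * ∏ p ∈ π, A p.1 p.2 := by
  unfold pfSub PMs msgn
  push_cast
  rfl

lemma pfSub_cast {S : Type*} [CommRing S] (A : ℕ → ℕ → ℤ) (J : Finset ℕ) :
    pfSub (fun a b => (A a b : S)) J = ((pfSub A J : ℤ) : S) := by
  rw [pfSub_eq, pfSub_eq]
  push_cast
  rfl

lemma pf_swap (B B' : ℕ → ℕ → ℤ) (J : Finset ℕ) (i j : ℕ) (hi : i ∈ J) (hj : j ∈ J)
    (hij : i < j) (hsym : ∀ a b, B a b = B b a)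
    (hB' : ∀ a ∈ J, ∀ b ∈ J, a ≠ b → B' a b = B (Equiv.swap i j a) (Equiv.swap i j b))
    (h0 : B i j = 0) (hm : ∀ k ∈ J, i < k → k < j → B i k = 0 ∧ B j k = 0) :
    pfSub B' J = - pfSub B J := by
  rw [pfSub_eq, pfSub_eq, ← Finset.sum_neg_distrib]
  have hf : ∀ x y, B (msrt x y).1 (msrt x y).2 = B x y := by
    intro x y
    rcases le_total x y with h | h
    · simp [msrt, h]
    · simp [msrt, h, hsym x y]
  refine Finset.sum_nbij' (fun π => π.image (mact i j)) (fun π => π.image (mact i j)) ?_ ?_ ?_ ?_ ?_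
  · intro π hπ
    rw [mem_PMs] at hπ ⊢
    exact mact_IsPM i j J hi hj π hπ
  · intro π hπ
    rw [mem_PMs] at hπ ⊢
    exact mact_IsPM i j J hi hj π hπ
  · intro π hπ
    rw [mem_PMs] at hπ
    exact mact_image_image i j J π hπ
  · intro π hπ
    rw [mem_PMs] at hπ
    exact mact_image_image i j J π hπ
  · intro π hπ
    rw [mem_PMs] at hπ
    have hprod : ∏ p ∈ π, B' p.1 p.2 = ∏ p ∈ π.image (mact i j), B p.1 p.2 := by
      rw [Finset.prod_image]
      · apply Finset.prod_congr rfl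
        intro p hp
        obtain ⟨ha, hb, hc⟩ := hπ.1 p hp
        rw [hB' _ ha _ hb hc.ne, mact, hf]
      · intro p hp q hq h
        rw [← mact_mact i j p (hπ.1 p hp).2.2, h, mact_mact i j q (hπ.1 q hq).2.2]
    rw [hprod]
    have hπ' := mact_IsPM i j J hi hj π hπ
    have hii := mact_image_image i j J π hπ
    set σ := π.image (mact i j) with hσ
    by_cases hz : ∏ p ∈ σ, B p.1 p.2 = 0
    · simp [hz]
    have key : msgn (σ.image (mact i j)) = - msgn σ := by
      apply msgn_act i j J hi hj hij σ hπ'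
      intro e he k hik hkj
      have hne : B e.1 e.2 ≠ 0 := fun h => hz (Finset.prod_eq_zero he h)
      obtain ⟨e1, e2, e3⟩ := hπ'.1 e he
      constructor
      · rintro rfl
        rw [hf] at hne
        have hki : k ≠ i := by
          rintro rfl; simp [msrt] at e3
        rcases eq_or_lt_of_le hkj with h | h
        · subst h; exact hne h0
        · have hk : k ∈ J := by
            simpa [msrt, hik] using e2
          exact hne (hm k hk (by omega) h).1
      · rintro rfl
        rw [hf] at hne
        have hki : k ≠ j := by
          rintro rfl; simp [msrt] at e3
        rcases eq_or_lt_of_le hik with h | h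
        · subst h; exact hne (by rw [hsym]; exact h0)
        · have hk : k ∈ J := by
            simpa [msrt, hkj] using e1
          exact hne (hm k hk h (by omega)).2
    rw [hii] at key
    rw [key]
    simp

lemma pm_remove (J : Finset ℕ) (e : ℕ × ℕ) (π : Finset (ℕ × ℕ)) (he : e ∉ π)
    (h : IsPM J (insert e π)) : IsPM ((J.erase e.1).erase e.2) π := by
  obtain ⟨h1, h2, h3⟩ := h
  refine ⟨?_, ?_, ?_⟩
  · intro p hp
    have hpe : p ≠ e := fun h => he (h ▸ hp)
    have a1 := h1 p (Finset.mem_insert_of_mem hp)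
    have a2 := h2 p (Finset.mem_insert_of_mem hp) e (Finset.mem_insert_self _ _) hpe
    simp only [Finset.mem_erase]
    tauto
  · intro p hp q hq
    exact h2 p (Finset.mem_insert_of_mem hp) q (Finset.mem_insert_of_mem hq)
  · intro k hk
    simp only [Finset.mem_erase] at hk
    obtain ⟨p, hp, hkp⟩ := h3 k hk.2.2
    rcases Finset.mem_insert.1 hp with rfl | hp
    · tauto
    · exact ⟨p, hp, hkp⟩

lemma pm_add (J : Finset ℕ) (a b : ℕ) (ha : a ∈ J) (hb : b ∈ J) (hab : a < b)
    (π : Finset (ℕ × ℕ)) (h : IsPM ((J.erase a).erase b) π) :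
    (a, b) ∉ π ∧ IsPM J (insert (a, b) π) := by
  obtain ⟨h1, h2, h3⟩ := h
  simp only [Finset.mem_erase] at h1 h3
  refine ⟨fun hc => (h1 _ hc).1.2.1 rfl, ?_, ?_, ?_⟩
  · intro p hp
    rcases Finset.mem_insert.1 hp with rfl | hp
    · exact ⟨ha, hb, hab⟩
    · have := h1 p hp; tauto
  · intro p hp q hq hpq
    rcases Finset.mem_insert.1 hp with rfl | hp <;> rcases Finset.mem_insert.1 hq with rfl | hq
    · exact absurd rfl hpq
    · have := h1 q hq
      simp only; refine ⟨?_, ?_, ?_, ?_⟩ <;> grind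
    · have := h1 p hp
      simp only; refine ⟨?_, ?_, ?_, ?_⟩ <;> grind
    · exact h2 p hp q hq hpq
  · intro k hk
    by_cases hka : k = a
    · exact ⟨(a, b), Finset.mem_insert_self _ _, Or.inl hka⟩
    by_cases hkb : k = b
    · exact ⟨(a, b), Finset.mem_insert_self _ _, Or.inr hkb⟩
    obtain ⟨p, hp, hh⟩ := h3 k ⟨hkb, hka, hk⟩
    exact ⟨p, Finset.mem_insert_of_mem hp, hh⟩

lemma pm_union (J K : Finset ℕ) (hd : Disjoint J K) (π ρ : Finset (ℕ × ℕ))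
    (h : IsPM J π) (h' : IsPM K ρ) : Disjoint π ρ ∧ IsPM (J ∪ K) (π ∪ ρ) := by
  obtain ⟨h1, h2, h3⟩ := h
  obtain ⟨h1', h2', h3'⟩ := h'
  rw [Finset.disjoint_left] at hd ⊢
  refine ⟨fun p hp hp' => hd (h1 p hp).1 (h1' p hp').1, ?_, ?_, ?_⟩
  · intro p hp
    simp only [Finset.mem_union] at hp ⊢
    rcases hp with hp | hp
    · have := h1 p hp; tauto
    · have := h1' p hp; tauto
  · intro p hp q hq hpq
    simp only [Finset.mem_union] at hp hq
    rcases hp with hp | hp <;> rcases hq with hq | hq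
    · exact h2 p hp q hq hpq
    · have a1 := h1 p hp
      have a2 := h1' q hq
      refine ⟨?_, ?_, ?_, ?_⟩ <;> grind
    · have a1 := h1' p hp
      have a2 := h1 q hq
      refine ⟨?_, ?_, ?_, ?_⟩ <;> grind
    · exact h2' p hp q hq hpq
  · intro k hk
    simp only [Finset.mem_union] at hk ⊢
    rcases hk with hk | hk
    · obtain ⟨p, hp, hh⟩ := h3 k hk; exact ⟨p, Or.inl hp, hh⟩
    · obtain ⟨p, hp, hh⟩ := h3' k hk; exact ⟨p, Or.inr hp, hh⟩

lemma sum_msgn (m : ℕ) : ∀ J : Finset ℕ, J.card = 2 * m → ∑ π ∈ PMs J, msgn π = 1 := by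
  induction m with
  | zero =>
    intro J hJ
    have : J = ∅ := by simpa using hJ
    subst this
    have : PMs ∅ = {∅} := by
      ext π
      rw [mem_PMs, Finset.mem_singleton]
      constructor
      · intro h
        apply Finset.eq_empty_of_forall_notMem
        intro p hp
        simpa using (h.1 p hp).1
      · rintro rfl
        simp [IsPM]
    rw [this]
    simp [msgn, crossNum]
  | succ m ih =>
    intro J hJ
    have hne : J.Nonempty := by
      rw [← Finset.card_pos]; omega
    set a := J.min' hne with ha
    have haJ : a ∈ J := Finset.min'_mem _ _
    have hne' : (J.erase a).Nonempty := by
      rw [← Finset.card_pos, Finset.card_erase_of_mem haJ]; omega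
    set b := (J.erase a).min' hne' with hb
    have hbJ' : b ∈ J.erase a := Finset.min'_mem _ _
    have hbJ : b ∈ J := Finset.mem_of_mem_erase hbJ'
    have hle : ∀ k ∈ J, a ≤ k := fun k hk => Finset.min'_le _ _ hk
    have hle' : ∀ k ∈ J, k ≠ a → b ≤ k := fun k hk h =>
      Finset.min'_le _ _ (Finset.mem_erase.2 ⟨h, hk⟩)
    have hba : b ≠ a := Finset.ne_of_mem_erase hbJ'
    have hab : a < b := lt_of_le_of_ne (hle b hbJ) hba.symm
    rw [← Finset.sum_filter_add_sum_filter_not (PMs J) (fun π => (a, b) ∈ π)]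
    have hz : ∑ π ∈ (PMs J).filter (fun π => (a, b) ∉ π), msgn π = 0 := by
      set B : ℕ → ℕ → ℤ := fun x y => if (x = a ∧ y = b) ∨ (x = b ∧ y = a) then 0 else 1 with hB
      have h1 : pfSub B J = - pfSub B J := by
        apply pf_swap B B J a b haJ hbJ hab
        · intro x y; simp only [hB]; congr 1; apply propext; tauto
        · intro x hx y hy hxy
          simp only [hB, Equiv.swap_apply_eq_iff, Equiv.swap_apply_left, Equiv.swap_apply_right]
          congr 1; apply propext; tauto
        · simp [hB]
        · intro k hk hak hkb
          exact absurd (hle' k hk hak.ne') (by omega)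
      have h2 : pfSub B J = 0 := by omega
      rw [← h2, pfSub_eq, Finset.sum_filter]
      apply Finset.sum_congr rfl
      intro π hπ
      rw [mem_PMs] at hπ
      by_cases h : (a, b) ∈ π
      swap
      · rw [if_pos h, Finset.prod_eq_one]
        · simp
        · intro p hp
          have := hπ.1 p hp
          simp only [hB]
          rw [if_neg]
          rintro (⟨h1, h2⟩ | ⟨h1, h2⟩)
          · apply h; rw [← h1, ← h2]; exact hp
          · omega
      · rw [if_neg (not_not.2 h), Finset.prod_eq_zero h]
        · simp
        · simp [hB]
    rw [hz, add_zero]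
    have hcard : ((J.erase a).erase b).card = 2 * m := by
      rw [Finset.card_erase_of_mem hbJ', Finset.card_erase_of_mem haJ]; omega
    rw [← ih _ hcard]
    refine Finset.sum_nbij' (fun π => π.erase (a, b)) (fun π => insert (a, b) π) ?_ ?_ ?_ ?_ ?_
    · intro π hπ
      rw [Finset.mem_filter, mem_PMs] at hπ
      rw [mem_PMs]
      apply pm_remove J (a, b) _ (by simp)
      rw [Finset.insert_erase hπ.2]; exact hπ.1
    · intro π hπ
      rw [mem_PMs] at hπ
      rw [Finset.mem_filter, mem_PMs]
      exact ⟨(pm_add J a b haJ hbJ hab π hπ).2, Finset.mem_insert_self _ _⟩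
    · intro π hπ
      rw [Finset.mem_filter, mem_PMs] at hπ
      exact Finset.insert_erase hπ.2
    · intro π hπ
      rw [mem_PMs] at hπ
      exact Finset.erase_insert (pm_add J a b haJ hbJ hab π hπ).1
    · intro π hπ
      rw [Finset.mem_filter, mem_PMs] at hπ
      conv_lhs => rw [← Finset.insert_erase hπ.2]
      rw [msgn_insert _ _ (by simp), Finset.prod_eq_one, mul_one]
      intro q hq
      rw [Finset.mem_erase] at hq
      obtain ⟨q1, q2, q3⟩ := hπ.1.1 q hq.2
      have q4 := hπ.1.2.1 _ hπ.2 q hq.2 hq.1.symm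
      simp only at q4
      have := hle' q.1 q1 q4.1.symm
      have := hle' q.2 q2 q4.2.1.symm
      unfold ms2 msg
      rw [if_neg (by simp only [mcr]; omega), if_neg (by simp only [mcr]; omega)]
      rfl

/-! ### Tuples -/

def Tup (P : ℕ → Finset (List V)) (J : Finset ℕ) : Finset (ℕ → List V) :=
  (J.pi P).image (fun f k => if h : k ∈ J then f k h else [])

lemma mem_Tup (P : ℕ → Finset (List V)) (J : Finset ℕ) (p : ℕ → List V) :
    p ∈ Tup P J ↔ (∀ k ∈ J, p k ∈ P k) ∧ ∀ k, k ∉ J → p k = [] := by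
  unfold Tup
  rw [Finset.mem_image]
  constructor
  · rintro ⟨f, hf, rfl⟩
    rw [Finset.mem_pi] at hf
    refine ⟨fun k hk => ?_, fun k hk => ?_⟩
    · simp only [hk, dif_pos]; exact hf k hk
    · simp only [hk]; simp
  · rintro ⟨h1, h2⟩
    refine ⟨fun k _ => p k, Finset.mem_pi.2 h1, ?_⟩
    funext k
    by_cases hk : k ∈ J
    · simp [hk]
    · simp [hk, h2 k hk]

lemma sum_Tup_insert (P : ℕ → Finset (List V)) (J : Finset ℕ) (a : ℕ) (ha : a ∉ J)
    (F : (ℕ → List V) → R) :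
    ∑ p ∈ Tup P (insert a J), F p = ∑ x ∈ P a, ∑ p ∈ Tup P J, F (Function.update p a x) := by
  rw [← Finset.sum_product' (f := fun x p => F (Function.update p a x))]
  refine Finset.sum_nbij' (fun p => (p a, Function.update p a [])) 
    (fun xp => Function.update xp.2 a xp.1) ?_ ?_ ?_ ?_ ?_
  · intro p hp
    rw [mem_Tup] at hp
    rw [Finset.mem_product, mem_Tup]
    refine ⟨hp.1 a (Finset.mem_insert_self _ _), fun k hk => ?_, fun k hk => ?_⟩
    · have : k ≠ a := fun h => ha (h ▸ hk)
      simp only [Function.update_of_ne this]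
      exact hp.1 k (Finset.mem_insert_of_mem hk)
    · by_cases h : k = a
      · subst h; simp
      · simp only [Function.update_of_ne h]
        exact hp.2 k (by simp [h, hk])
  · rintro ⟨x, p⟩ hp
    rw [Finset.mem_product, mem_Tup] at hp
    rw [mem_Tup]
    obtain ⟨hx, h1, h2⟩ := hp
    simp only at hx h1 h2 ⊢
    refine ⟨fun k hk => ?_, fun k hk => ?_⟩
    · by_cases h : k = a
      · subst h; simpa using hx
      · rw [Function.update_of_ne h]
        exact h1 k (Finset.mem_of_mem_insert_of_ne hk h)
    · simp only [Finset.mem_insert, not_or] at hk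
      rw [Function.update_of_ne hk.1]
      exact h2 k hk.2
  · intro p hp
    simp
  · rintro ⟨x, p⟩ hp
    rw [Finset.mem_product, mem_Tup] at hp
    have : p a = [] := hp.2.2 a ha
    simp [← this]
  · intro p hp
    simp

lemma pm_empty (J : Finset ℕ) (h : IsPM J ∅) : J = ∅ := by
  apply Finset.eq_empty_of_forall_notMem
  intro k hk
  obtain ⟨p, hp, _⟩ := h.2.2 k hk
  simp at hp

lemma pm_decomp (J : Finset ℕ) (e : ℕ × ℕ) (π : Finset (ℕ × ℕ))
    (h : IsPM J (insert e π)) : J = insert e.1 (insert e.2 ((J.erase e.1).erase e.2)) := by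
  have := h.1 e (Finset.mem_insert_self _ _)
  rw [Finset.insert_erase, Finset.insert_erase this.1]
  rw [Finset.mem_erase]
  exact ⟨this.2.2.ne', this.2.1⟩

lemma expand (P : ℕ → Finset (List V)) (F : List V → List V → R) (π : Finset (ℕ × ℕ)) :
    ∀ J, IsPM J π → ∏ e ∈ π, ∑ x ∈ P e.1, ∑ y ∈ P e.2, F x y =
      ∑ p ∈ Tup P J, ∏ e ∈ π, F (p e.1) (p e.2) := by
  induction π using Finset.induction_on with
  | empty =>
    intro J hJ
    rw [pm_empty J hJ]
    simp [Tup]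
  | insert e π he ih =>
    intro J hJ
    have h' := pm_remove J e π he hJ
    have hlt := (hJ.1 e (Finset.mem_insert_self _ _)).2.2
    rw [pm_decomp J e π hJ, sum_Tup_insert _ _ _ (by simp [hlt.ne])]
    simp_rw [sum_Tup_insert P ((J.erase e.1).erase e.2) e.2 (by simp)]
    rw [Finset.prod_insert he, ih _ h', Finset.sum_mul]
    apply Finset.sum_congr rfl
    intro x hx
    rw [Finset.sum_mul]
    apply Finset.sum_congr rfl
    intro y hy
    rw [Finset.mul_sum]
    apply Finset.sum_congr rfl
    intro p hp
    rw [Finset.prod_insert he]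
    congr 1
    · rw [Function.update_self, Function.update_of_ne hlt.ne', Function.update_self]
    · apply Finset.prod_congr rfl
      intro q hq
      have hh := h'.1 q hq
      simp only [Finset.mem_erase] at hh
      rw [Function.update_of_ne hh.1.2.1, Function.update_of_ne hh.1.1,
        Function.update_of_ne hh.2.1.2.1, Function.update_of_ne hh.2.1.1]

lemma pm_prod (h : ℕ → R) (π : Finset (ℕ × ℕ)) :
    ∀ J, IsPM J π → ∏ e ∈ π, (h e.1 * h e.2) = ∏ k ∈ J, h k := by
  induction π using Finset.induction_on with
  | empty =>
    intro J hJ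
    rw [pm_empty J hJ]
    simp
  | insert e π he ih =>
    intro J hJ
    have h' := pm_remove J e π he hJ
    have hlt := (hJ.1 e (Finset.mem_insert_self _ _)).2.2
    have n1 : e.1 ∉ insert e.2 ((J.erase e.1).erase e.2) := by simp [hlt.ne]
    have n2 : e.2 ∉ (J.erase e.1).erase e.2 := by simp
    rw [pm_decomp J e π hJ, Finset.prod_insert n1,
      Finset.prod_insert n2, Finset.prod_insert he, ih _ h']
    ring

/-! ### List paths -/

def lwt (w : V → V → R) (l : List V) : R := ((l.zip l.tail).map fun e => w e.1 e.2).prod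

lemma lwt_split (w : V → V → R) (v : V) (l2 : List V) : ∀ l1 : List V,
    lwt w (l1 ++ v :: l2) = lwt w (l1 ++ [v]) * lwt w (v :: l2)
  | [] => by simp [lwt]
  | [x] => by simp [lwt]
  | x :: y :: l => by
    have := lwt_split w v l2 (y :: l)
    simp only [lwt, List.cons_append, List.tail_cons, List.zip_cons_cons, List.map_cons,
      List.prod_cons] at this ⊢
    rw [this]
    ring

def LP (E : V → V → Prop) (u : ℕ → V) (W : List V) (k : ℕ) : Set (List V) :=
  {l | l.IsChain E ∧ l.head? = some (u k) ∧ ∃ y ∈ W, l.getLast? = some y}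

lemma chain_pairwise (E : V → V → Prop) (l : List V) (h : l.IsChain E) :
    l.Pairwise (Relation.TransGen E) := by
  have : l.IsChain (Relation.TransGen E) := h.imp (fun _ _ h => Relation.TransGen.single h)
  exact List.isChain_iff_pairwise.1 this

lemma chain_nodup (E : V → V → Prop) (hac : ∀ v : V, ¬Relation.TransGen E v v)
    (l : List V) (h : l.IsChain E) : l.Nodup := by
  refine (chain_pairwise E l h).imp ?_
  rintro a b h rfl
  exact hac a h

lemma LP_finite [Fintype V] (E : V → V → Prop) (hac : ∀ v : V, ¬Relation.TransGen E v v)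
    (u : ℕ → V) (W : List V) (k : ℕ) : (LP E u W k).Finite := by
  apply (List.finite_length_le V (Fintype.card V)).subset
  intro l hl
  exact (chain_nodup E hac l hl.1).length_le_card

lemma chain_before (E : V → V → Prop) (l1 l2 : List V) (v x : V)
    (h : (l1 ++ v :: l2).IsChain E) (hx : x ∈ l1) : Relation.TransGen E x v := by
  have := chain_pairwise E _ h
  rw [List.pairwise_append] at this
  exact this.2.2 x hx v (by simp)

lemma LP_swap (E : V → V → Prop) (u : ℕ → V) (W : List V) (i j : ℕ) (l1 l2 m1 m2 : List V) (v : V)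
    (h : l1 ++ v :: l2 ∈ LP E u W i) (h' : m1 ++ v :: m2 ∈ LP E u W j) :
    l1 ++ v :: m2 ∈ LP E u W i := by
  obtain ⟨a1, a2, a3⟩ := h
  obtain ⟨b1, b2, b3⟩ := h'
  refine ⟨?_, ?_, ?_⟩
  · rw [List.isChain_split] at a1 b1 ⊢
    exact ⟨a1.1, b1.2⟩
  · cases l1 <;> simpa using a2
  · simpa [List.getLast?_append] using b3

def hsw (v : V) (l m : List V) : List V :=
  l.takeWhile (fun x => decide (x ≠ v)) ++ m.dropWhile (fun x => decide (x ≠ v))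

lemma hsw_eq (v : V) (l1 l2 m1 m2 : List V) (hl : v ∉ l1) (hm : v ∉ m1) :
    hsw v (l1 ++ v :: l2) (m1 ++ v :: m2) = l1 ++ v :: m2 := by
  unfold hsw
  rw [List.takeWhile_append_of_pos, List.dropWhile_append_of_pos]
  · simp
  · intro a ha; simp; rintro rfl; exact hm ha
  · intro a ha; simp; rintro rfl; exact hl ha

def stp (v : V) (i j : ℕ) (p : ℕ → List V) : ℕ → List V :=
  Function.update (Function.update p i (hsw v (p i) (p j))) j (hsw v (p j) (p i))

def Bm (p : ℕ → List V) (a b : ℕ) : ℤ := if List.Disjoint (p a) (p b) then 1 else 0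

def Xs (J : Finset ℕ) (p : ℕ → List V) : Set V :=
  {v | ∃ a ∈ J, ∃ b ∈ J, a ≠ b ∧ v ∈ p a ∧ v ∈ p b}

lemma split_first (v : V) (l : List V) (h : v ∈ l) : ∃ l1 l2, l = l1 ++ v :: l2 ∧ v ∉ l1 := by
  obtain ⟨l1, l2, h1, h2⟩ := List.eq_append_cons_of_mem h
  exact ⟨l1, l2, h1, h2⟩

/-- everything needed about one tail swap -/
lemma stp_spec (v : V) (i j : ℕ) (hij : i ≠ j) (p : ℕ → List V) (hi : v ∈ p i) (hj : v ∈ p j) :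
    ∃ l1 l2 m1 m2, p i = l1 ++ v :: l2 ∧ p j = m1 ++ v :: m2 ∧ v ∉ l1 ∧ v ∉ m1 ∧
      stp v i j p i = l1 ++ v :: m2 ∧ stp v i j p j = m1 ++ v :: l2 ∧
      ∀ k, k ≠ i → k ≠ j → stp v i j p k = p k := by
  obtain ⟨l1, l2, hl, hl1⟩ := split_first v _ hi
  obtain ⟨m1, m2, hm, hm1⟩ := split_first v _ hj
  refine ⟨l1, l2, m1, m2, hl, hm, hl1, hm1, ?_, ?_, ?_⟩
  · rw [stp, Function.update_of_ne hij, Function.update_self, hl, hm, hsw_eq _ _ _ _ _ hl1 hm1]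
  · rw [stp, Function.update_self, hl, hm, hsw_eq _ _ _ _ _ hm1 hl1]
  · intro k h1 h2
    rw [stp, Function.update_of_ne h2, Function.update_of_ne h1]

lemma stp_stp (v : V) (i j : ℕ) (hij : i ≠ j) (p : ℕ → List V) (hi : v ∈ p i) (hj : v ∈ p j) :
    stp v i j (stp v i j p) = p := by
  obtain ⟨l1, l2, m1, m2, hl, hm, hl1, hm1, h1, h2, h3⟩ := stp_spec v i j hij p hi hj
  funext k
  by_cases hki : k = i
  · subst hki
    rw [stp, Function.update_of_ne hij, Function.update_self, h1, h2, hsw_eq _ _ _ _ _ hl1 hm1, hl]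
  by_cases hkj : k = j
  · subst hkj
    rw [stp, Function.update_self, h1, h2, hsw_eq _ _ _ _ _ hm1 hl1, hm]
  rw [stp, Function.update_of_ne hkj, Function.update_of_ne hki, h3 k hki hkj]

lemma Xs_stp_sub (v : V) (i j : ℕ) (hij : i ≠ j) (J : Finset ℕ) (hiJ : i ∈ J) (hjJ : j ∈ J)
    (p : ℕ → List V) (hi : v ∈ p i) (hj : v ∈ p j)
    (hni : (p i).Nodup) (hnj : (p j).Nodup) : Xs J (stp v i j p) ⊆ Xs J p := by
  obtain ⟨l1, l2, m1, m2, hl, hm, hl1, hm1, h1, h2, h3⟩ := stp_spec v i j hij p hi hj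
  rw [hl] at hni
  rw [hm] at hnj
  have key : ∀ a ∈ J, ∀ x, x ∈ stp v i j p a → ∃ b ∈ J, x ∈ p b ∧
      ((a ≠ i ∧ a ≠ j) → b = a) ∧ ((a = i ∨ a = j) → (b = i ∨ b = j)) := by
    intro a ha x hx
    by_cases hai : a = i
    · subst hai
      rw [h1] at hx
      rcases List.mem_append.1 hx with h | h
      · exact ⟨a, ha, by rw [hl]; simp [h], by tauto, by tauto⟩
      · exact ⟨j, hjJ, by rw [hm]; exact List.mem_append_right _ h, by tauto, by tauto⟩
    by_cases haj : a = j
    · subst haj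
      rw [h2] at hx
      rcases List.mem_append.1 hx with h | h
      · exact ⟨a, ha, by rw [hm]; simp [h], by tauto, by tauto⟩
      · exact ⟨i, hiJ, by rw [hl]; exact List.mem_append_right _ h, by tauto, by tauto⟩
    rw [h3 a hai haj] at hx
    exact ⟨a, ha, hx, by tauto, by tauto⟩
  have both : ∀ x, x ∈ stp v i j p i → x ∈ stp v i j p j → x ∈ p i ∧ x ∈ p j := by
    intro x hx hy
    rw [h1] at hx
    rw [h2] at hy
    rw [hl, hm]
    rw [List.nodup_append] at hni hnj
    rcases List.mem_append.1 hx with h | h <;> rcases List.mem_append.1 hy with h' | h'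
    · exact ⟨List.mem_append_left _ h, List.mem_append_left _ h'⟩
    · exact absurd rfl (hni.2.2 x h x h')
    · exact absurd rfl (hnj.2.2 x h' x h)
    · exact ⟨List.mem_append_right _ h', List.mem_append_right _ h⟩
  rintro x ⟨a, ha, b, hb, hab, hxa, hxb⟩
  by_cases hboth : (a = i ∧ b = j) ∨ (a = j ∧ b = i)
  · rcases hboth with ⟨rfl, rfl⟩ | ⟨rfl, rfl⟩
    · exact ⟨a, ha, b, hb, hab, both x hxa hxb⟩
    · exact ⟨b, hb, a, ha, hab.symm, both x hxb hxa⟩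
  obtain ⟨a', ha', hxa', c1, c2⟩ := key a ha x hxa
  obtain ⟨b', hb', hxb', d1, d2⟩ := key b hb x hxb
  refine ⟨a', ha', b', hb', ?_, hxa', hxb'⟩
  by_cases e1 : a = i ∨ a = j
  · have e2 : b ≠ i ∧ b ≠ j := by
      refine ⟨fun hb => ?_, fun hb => ?_⟩ <;> rcases e1 with h | h
      · exact hab (h.trans hb.symm)
      · exact hboth (Or.inr ⟨h, hb⟩)
      · exact hboth (Or.inl ⟨h, hb⟩)
      · exact hab (h.trans hb.symm)
    rw [d1 e2]
    rcases c2 e1 with h | h <;> rw [h]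
    · exact e2.1.symm
    · exact e2.2.symm
  · push Not at e1
    rw [c1 e1]
    by_cases e2 : b = i ∨ b = j
    · rcases d2 e2 with h | h <;> rw [h]
      · exact e1.1
      · exact e1.2
    · push Not at e2
      rw [d1 e2]; exact hab

lemma Bm_comm (p : ℕ → List V) (a b : ℕ) : Bm p a b = Bm p b a := by
  unfold Bm; rw [List.disjoint_comm]

/-! ### The involution -/

def LCompat (E : V → V → Prop) (u : ℕ → V) (W : List V) (N : Finset ℕ) : Prop :=
  ∀ i ∈ N, ∀ j ∈ N, i < j → ∀ l ∈ LP E u W i, ∀ m ∈ LP E u W j,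
    ∀ a b : Fin W.length, b < a → l.getLast? = some (W.get a) → m.getLast? = some (W.get b) →
      ¬ List.Disjoint l m

lemma between (E : V → V → Prop) (u : ℕ → V) (W : List V) (N : Finset ℕ)
    (hc : LCompat E u W N) (i k j : ℕ) (hi : i ∈ N) (hk : k ∈ N) (hj : j ∈ N)
    (hik : i < k) (hkj : k < j) (l m l' : List V) (hl : l ∈ LP E u W i) (hm : m ∈ LP E u W k)
    (hl' : l' ∈ LP E u W j) (hlast : l.getLast? = l'.getLast?)
    (h1 : List.Disjoint l m) (h2 : List.Disjoint l' m) : False := by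
  obtain ⟨y, hy, hy'⟩ := hl.2.2
  obtain ⟨z, hz, hz'⟩ := hm.2.2
  obtain ⟨a, ha⟩ := List.mem_iff_get.1 hy
  obtain ⟨b, hb⟩ := List.mem_iff_get.1 hz
  rcases lt_trichotomy a b with h | h | h
  · exact hc k hk j hj hkj m hm l' hl' b a h (by rw [hb, hz']) (by rw [← hlast, ha, hy']) h2.symm
  · subst h
    have hyz : y = z := ha.symm.trans hb
    subst hyz
    exact h1 (List.mem_of_getLast? hy') (List.mem_of_getLast? hz')
  · exact hc i hi k hk hik l hl m hm a b h (by rw [ha, hy']) (by rw [hb, hz']) h1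

lemma disj_stp (E : V → V → Prop) (J : Finset ℕ) (v : V) (a k : ℕ) (ha : a ∈ J) (hk : k ∈ J)
    (hak : k ≠ a) (p : ℕ → List V) (hmin : ∀ x ∈ Xs J p, ¬ Relation.TransGen E x v)
    (l1 l2 : List V) (hp : p a = l1 ++ v :: l2) (hch : (p a).IsChain E) (t : List V) :
    List.Disjoint (l1 ++ v :: t) (p k) ↔ List.Disjoint (v :: t) (p k) := by
  rw [List.disjoint_append_left]
  refine ⟨fun h => h.2, fun h => ⟨?_, h⟩⟩
  intro x hx hxk
  refine hmin x ⟨a, ha, k, hk, hak.symm, ?_, hxk⟩ ?_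
  · rw [hp]; exact List.mem_append_left _ hx
  · rw [hp] at hch; exact chain_before E l1 l2 v x hch hx

lemma pf_stp (E : V → V → Prop) (u : ℕ → V) (W : List V) (N J : Finset ℕ)
    (hJN : J ⊆ N) (hc : LCompat E u W N) (p : ℕ → List V) (hp : ∀ k ∈ N, p k ∈ LP E u W k)
    (v : V) (i j : ℕ) (hi : i ∈ J) (hj : j ∈ J) (hij : i < j) (hvi : v ∈ p i) (hvj : v ∈ p j)
    (hmin : ∀ x ∈ Xs J p, ¬ Relation.TransGen E x v) :
    pfSub (Bm (stp v i j p)) J = - pfSub (Bm p) J := by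
  obtain ⟨l1, l2, m1, m2, hl, hm, hl1, hm1, h1, h2, h3⟩ := stp_spec v i j hij.ne p hvi hvj
  have pi := hp i (hJN hi)
  have pj := hp j (hJN hj)
  have di : ∀ k ∈ J, k ≠ i → k ≠ j →
      (List.Disjoint (stp v i j p i) (p k) ↔ List.Disjoint (p j) (p k)) := by
    intro k hk hki hkj
    rw [h1, disj_stp E J v i k hi hk hki p hmin l1 l2 hl pi.1 m2, hm,
      disj_stp E J v j k hj hk hkj p hmin m1 m2 hm pj.1 m2]
  have dj : ∀ k ∈ J, k ≠ i → k ≠ j →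
      (List.Disjoint (stp v i j p j) (p k) ↔ List.Disjoint (p i) (p k)) := by
    intro k hk hki hkj
    rw [h2, disj_stp E J v j k hj hk hkj p hmin m1 m2 hm pj.1 l2, hl,
      disj_stp E J v i k hi hk hki p hmin l1 l2 hl pi.1 l2]
  have b0 : Bm p i j = 0 := by
    unfold Bm; rw [if_neg]; intro h; exact h hvi hvj
  have b0' : Bm (stp v i j p) i j = 0 := by
    unfold Bm; rw [if_neg]; intro h; rw [h1, h2] at h
    exact h (a := v) (by simp) (by simp)
  have bi : ∀ k ∈ J, k ≠ i → k ≠ j → Bm (stp v i j p) i k = Bm p j k := by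
    intro k hk hki hkj
    unfold Bm
    rw [h3 k hki hkj, di k hk hki hkj]
  have bj : ∀ k ∈ J, k ≠ i → k ≠ j → Bm (stp v i j p) j k = Bm p i k := by
    intro k hk hki hkj
    unfold Bm
    rw [h3 k hki hkj, dj k hk hki hkj]
  apply pf_swap (Bm p) (Bm (stp v i j p)) J i j hi hj hij (Bm_comm p)
  · intro a ha b hb hab
    by_cases hai : a = i
    · subst hai
      rw [Equiv.swap_apply_left]
      by_cases hbj : b = j
      · subst hbj; rw [Equiv.swap_apply_right, b0', Bm_comm, b0]
      · rw [Equiv.swap_apply_of_ne_of_ne hab.symm hbj, bi b hb hab.symm hbj]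
    by_cases haj : a = j
    · subst haj
      rw [Equiv.swap_apply_right]
      by_cases hbi : b = i
      · subst hbi; rw [Equiv.swap_apply_left, Bm_comm, b0', b0]
      · rw [Equiv.swap_apply_of_ne_of_ne hbi hab.symm, bj b hb hbi hab.symm]
    rw [Equiv.swap_apply_of_ne_of_ne hai haj]
    by_cases hbi : b = i
    · subst hbi
      rw [Equiv.swap_apply_left, Bm_comm, bi a ha hai haj, Bm_comm]
    by_cases hbj : b = j
    · subst hbj
      rw [Equiv.swap_apply_right, Bm_comm, bj a ha hai haj, Bm_comm]
    rw [Equiv.swap_apply_of_ne_of_ne hbi hbj]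
    unfold Bm
    rw [h3 a hai haj, h3 b hbi hbj]
  · exact b0
  · intro k hk hik hkj
    have qi : stp v i j p i ∈ LP E u W i := by
      rw [h1]; rw [hl] at pi; rw [hm] at pj
      exact LP_swap E u W i j l1 l2 m1 m2 v pi pj
    have qj : stp v i j p j ∈ LP E u W j := by
      rw [h2]; rw [hl] at pi; rw [hm] at pj
      exact LP_swap E u W j i m1 m2 l1 l2 v pj pi
    constructor
    · unfold Bm; rw [if_neg]; intro h
      refine between E u W N hc i k j (hJN hi) (hJN hk) (hJN hj) hik hkj (p i) (p k)
        (stp v i j p j) pi (hp k (hJN hk)) qj ?_ h ((dj k hk hik.ne' hkj.ne).2 h)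
      rw [hl, h2]; simp [List.getLast?_append, List.getLast?_cons]
    · unfold Bm; rw [if_neg]; intro h
      refine between E u W N hc i k j (hJN hi) (hJN hk) (hJN hj) hik hkj (stp v i j p i) (p k)
        (p j) qi (hp k (hJN hk)) pj ?_ ((di k hk hik.ne' hkj.ne).2 h) h
      rw [hm, h1]; simp [List.getLast?_append, List.getLast?_cons]

def NI (J : Finset ℕ) (p : ℕ → List V) : Prop :=
  ∀ a ∈ J, ∀ b ∈ J, a ≠ b → List.Disjoint (p a) (p b)

def vsel (E : V → V → Prop) (v0 : V) (S : Set V) : V :=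
  if h : ∃ v ∈ S, ∀ x ∈ S, ¬ Relation.TransGen E x v then h.choose else v0

def psel (S : Set ℕ) : ℕ × ℕ :=
  if h : ∃ ij : ℕ × ℕ, ij.1 ∈ S ∧ ij.2 ∈ S ∧ ij.1 < ij.2 then h.choose else (0, 0)

def inv1 (E : V → V → Prop) (v0 : V) (J : Finset ℕ) (p : ℕ → List V) : ℕ → List V :=
  stp (vsel E v0 (Xs J p)) (psel {k | k ∈ J ∧ vsel E v0 (Xs J p) ∈ p k}).1
    (psel {k | k ∈ J ∧ vsel E v0 (Xs J p) ∈ p k}).2 p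

lemma inv1_spec [Fintype V] (E : V → V → Prop) (hac : ∀ v : V, ¬Relation.TransGen E v v) (v0 : V)
    (J : Finset ℕ) (p : ℕ → List V) (h : ¬ NI J p) :
    ∃ v i j, v = vsel E v0 (Xs J p) ∧ (i, j) = psel {k | k ∈ J ∧ v ∈ p k} ∧
      i ∈ J ∧ j ∈ J ∧ i < j ∧ v ∈ p i ∧ v ∈ p j ∧
      (∀ x ∈ Xs J p, ¬ Relation.TransGen E x v) ∧ inv1 E v0 J p = stp v i j p := by
  have hne : (Xs J p).Nonempty := by
    unfold NI at h
    push Not at h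
    obtain ⟨a, ha, b, hb, hab, hd⟩ := h
    unfold List.Disjoint at hd
    push Not at hd
    obtain ⟨x, hx, hy, _⟩ := hd
    exact ⟨x, a, ha, b, hb, hab, hx, hy⟩
  have hwf : WellFounded (Relation.TransGen E) := by
    have : Std.Irrefl (Relation.TransGen E) := ⟨hac⟩
    exact Finite.wellFounded_of_trans_of_irrefl _
  have hex : ∃ v ∈ Xs J p, ∀ x ∈ Xs J p, ¬ Relation.TransGen E x v :=
    hwf.has_min _ hne
  have hv : vsel E v0 (Xs J p) ∈ Xs J p ∧
      ∀ x ∈ Xs J p, ¬ Relation.TransGen E x (vsel E v0 (Xs J p)) := by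
    unfold vsel; rw [dif_pos hex]; exact hex.choose_spec
  set v := vsel E v0 (Xs J p) with hvdef
  obtain ⟨a, ha, b, hb, hab, hxa, hxb⟩ := hv.1
  have hex2 : ∃ ij : ℕ × ℕ, ij.1 ∈ {k | k ∈ J ∧ v ∈ p k} ∧ ij.2 ∈ {k | k ∈ J ∧ v ∈ p k} ∧
      ij.1 < ij.2 := by
    rcases lt_or_gt_of_ne hab with h | h
    · exact ⟨(a, b), ⟨ha, hxa⟩, ⟨hb, hxb⟩, h⟩
    · exact ⟨(b, a), ⟨hb, hxb⟩, ⟨ha, hxa⟩, h⟩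
  have hps : (psel {k | k ∈ J ∧ v ∈ p k}).1 ∈ {k | k ∈ J ∧ v ∈ p k} ∧
      (psel {k | k ∈ J ∧ v ∈ p k}).2 ∈ {k | k ∈ J ∧ v ∈ p k} ∧
      (psel {k | k ∈ J ∧ v ∈ p k}).1 < (psel {k | k ∈ J ∧ v ∈ p k}).2 := by
    unfold psel; rw [dif_pos hex2]; exact hex2.choose_spec
  exact ⟨v, _, _, rfl, rfl, hps.1.1, hps.2.1.1, hps.2.2, hps.1.2, hps.2.1.2, hv.2, rfl⟩

lemma stp_LP (E : V → V → Prop) (u : ℕ → V) (W : List V) (N : Finset ℕ)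
    (p : ℕ → List V) (hp : ∀ k ∈ N, p k ∈ LP E u W k)
    (v : V) (i j : ℕ) (hi : i ∈ N) (hj : j ∈ N) (hij : i < j) (hvi : v ∈ p i) (hvj : v ∈ p j) :
    ∀ k ∈ N, stp v i j p k ∈ LP E u W k := by
  obtain ⟨l1, l2, m1, m2, hl, hm, hl1, hm1, h1, h2, h3⟩ := stp_spec v i j hij.ne p hvi hvj
  have pi := hp i hi
  have pj := hp j hj
  rw [hl] at pi; rw [hm] at pj
  intro k hk
  by_cases hki : k = i
  · subst hki; rw [h1]
    exact LP_swap E u W k j l1 l2 m1 m2 v pi pj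
  by_cases hkj : k = j
  · subst hkj; rw [h2]
    exact LP_swap E u W k i m1 m2 l1 l2 v pj pi
  rw [h3 k hki hkj]; exact hp k hk

lemma NI_iff (J : Finset ℕ) (p : ℕ → List V) : NI J p ↔ Xs J p = ∅ := by
  rw [Set.eq_empty_iff_forall_notMem]
  constructor
  · rintro h x ⟨a, ha, b, hb, hab, hx, hy⟩
    exact h a ha b hb hab hx hy
  · intro h a ha b hb hab x hx hy
    exact h x ⟨a, ha, b, hb, hab, hx, hy⟩

lemma stp_prod (w : V → V → R) (N : Finset ℕ) (p : ℕ → List V)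
    (v : V) (i j : ℕ) (hi : i ∈ N) (hj : j ∈ N) (hij : i < j) (hvi : v ∈ p i) (hvj : v ∈ p j) :
    ∏ k ∈ N, lwt w (stp v i j p k) = ∏ k ∈ N, lwt w (p k) := by
  obtain ⟨l1, l2, m1, m2, hl, hm, hl1, hm1, h1, h2, h3⟩ := stp_spec v i j hij.ne p hvi hvj
  have hj' : j ∈ N.erase i := Finset.mem_erase.2 ⟨hij.ne', hj⟩
  rw [← Finset.mul_prod_erase N _ hi, ← Finset.mul_prod_erase N _ hi,
    ← Finset.mul_prod_erase _ _ hj', ← Finset.mul_prod_erase _ _ hj', h1, h2, hl, hm,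
    lwt_split w v m2 l1, lwt_split w v l2 m1, lwt_split w v m2 m1, lwt_split w v l2 l1]
  have : ∏ k ∈ (N.erase i).erase j, lwt w (stp v i j p k) =
      ∏ k ∈ (N.erase i).erase j, lwt w (p k) := by
    apply Finset.prod_congr rfl
    intro k hk
    simp only [Finset.mem_erase] at hk
    rw [h3 k hk.2.1 hk.1]
  rw [this]
  ring

lemma pf_NI (J : Finset ℕ) (hev : Even J.card) (p : ℕ → List V) (h : NI J p) :
    pfSub (Bm p) J = 1 := by
  obtain ⟨m, hm⟩ := hev
  rw [← sum_msgn m J (by omega), pfSub_eq]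
  apply Finset.sum_congr rfl
  intro π hπ
  rw [mem_PMs] at hπ
  rw [Finset.prod_eq_one]
  · simp
  · intro e he
    obtain ⟨h1, h2, h3⟩ := hπ.1 e he
    unfold Bm
    rw [if_pos (h _ h1 _ h2 h3.ne)]

lemma cancel [Fintype V] (E : V → V → Prop) (w : V → V → R)
    (hac : ∀ v : V, ¬Relation.TransGen E v v)
    (u : ℕ → V) (W : List V) (N J : Finset ℕ) (P : ℕ → Finset (List V))
    (hP : ∀ k l, l ∈ P k ↔ l ∈ LP E u W k) (hev : Even J.card)
    (hJN : J ⊆ N) (hc : LCompat E u W N) (g : (ℕ → List V) → R)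
    (hg : ∀ p p' : ℕ → List V, (∀ k, k ∉ J → p k = p' k) → g p = g p') :
    ∑ p ∈ Tup P N, (∏ k ∈ N, lwt w (p k)) * ((pfSub (Bm p) J : ℤ) : R) * g p =
      ∑ p ∈ Tup P N, (∏ k ∈ N, lwt w (p k)) * (if NI J p then 1 else 0) * g p := by
  rw [← Finset.sum_filter_add_sum_filter_not (Tup P N) (fun p => NI J p)]
  have hz : ∑ p ∈ (Tup P N).filter (fun p => ¬ NI J p),
      (∏ k ∈ N, lwt w (p k)) * ((pfSub (Bm p) J : ℤ) : R) * g p = 0 := by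
    have main : ∀ p ∈ (Tup P N).filter (fun p => ¬ NI J p),
        inv1 E (u 0) J p ∈ (Tup P N).filter (fun p => ¬ NI J p) ∧
        inv1 E (u 0) J (inv1 E (u 0) J p) = p ∧
        pfSub (Bm (inv1 E (u 0) J p)) J = - pfSub (Bm p) J ∧
        ∏ k ∈ N, lwt w (inv1 E (u 0) J p k) = ∏ k ∈ N, lwt w (p k) ∧
        g (inv1 E (u 0) J p) = g p := by
      intro p hp
      rw [Finset.mem_filter, mem_Tup] at hp
      obtain ⟨⟨hpP, hp0⟩, hNI⟩ := hp
      have hpL : ∀ k ∈ N, p k ∈ LP E u W k := fun k hk => (hP k _).1 (hpP k hk)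
      obtain ⟨v, i, j, hv, hps, hi, hj, hij, hvi, hvj, hmin, hinv⟩ :=
        inv1_spec E hac (u 0) J p hNI
      have hqL := stp_LP E u W N p hpL v i j (hJN hi) (hJN hj) hij hvi hvj
      have hss := stp_stp v i j hij.ne p hvi hvj
      obtain ⟨l1, l2, m1, m2, hl, hm, hl1, hm1, h1, h2, h3⟩ := stp_spec v i j hij.ne p hvi hvj
      rw [hinv]
      set q := stp v i j p with hq
      have hvi' : v ∈ q i := by rw [h1]; simp
      have hvj' : v ∈ q j := by rw [h2]; simp
      have hX : Xs J q = Xs J p := by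
        apply Set.Subset.antisymm
        · exact Xs_stp_sub v i j hij.ne J hi hj p hvi hvj
            (chain_nodup E hac _ (hpL i (hJN hi)).1) (chain_nodup E hac _ (hpL j (hJN hj)).1)
        · have := Xs_stp_sub v i j hij.ne J hi hj q hvi' hvj'
            (chain_nodup E hac _ (hqL i (hJN hi)).1) (chain_nodup E hac _ (hqL j (hJN hj)).1)
          rwa [hss] at this
      have hS : {k | k ∈ J ∧ v ∈ q k} = {k | k ∈ J ∧ v ∈ p k} := by
        ext k
        simp only [Set.mem_ofPred_eq]
        by_cases hki : k = i
        · subst hki; simp [hvi, hvi']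
        by_cases hkj : k = j
        · subst hkj; simp [hvj, hvj']
        rw [h3 k hki hkj]
      have hqNI : ¬ NI J q := by
        rw [NI_iff, hX, ← NI_iff]; exact hNI
      refine ⟨?_, ?_, ?_, ?_, ?_⟩
      · rw [Finset.mem_filter, mem_Tup]
        refine ⟨⟨fun k hk => (hP k _).2 (hqL k hk), fun k hk => ?_⟩, hqNI⟩
        rw [h3 k (fun h => hk (h ▸ hJN hi)) (fun h => hk (h ▸ hJN hj))]
        exact hp0 k hk
      · unfold inv1
        rw [hX, ← hv, hS, ← hps]
        exact hss
      · exact pf_stp E u W N J hJN hc p hpL v i j hi hj hij hvi hvj hmin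
      · exact stp_prod w N p v i j (hJN hi) (hJN hj) hij hvi hvj
      · apply hg
        intro k hk
        exact h3 k (fun h => hk (h ▸ hi)) (fun h => hk (h ▸ hj))
    refine Finset.sum_involution (fun p _ => inv1 E (u 0) J p) ?_ ?_ ?_ ?_
    · intro p hp
      obtain ⟨_, _, c, d, e⟩ := main p hp
      rw [c, d, e]
      push_cast
      ring
    · intro p hp hne heq
      obtain ⟨_, _, c, d, e⟩ := main p hp
      rw [heq] at c
      have : pfSub (Bm p) J = 0 := by omega
      apply hne
      rw [this]; simp
    · intro p hp
      exact (main p hp).1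
    · intro p hp
      exact (main p hp).2.1
  rw [hz, add_zero, Finset.sum_filter]
  apply Finset.sum_congr rfl
  intro p hp
  split_ifs with h
  · rw [pf_NI J hev p h]; simp
  · simp

/-! ### Translation to list paths -/

lemma path_LP (E : V → V → Prop) (u : ℕ → V) (W : List V) (k : ℕ) (x : V × List V) :
    (∃ y ∈ W, PathFromTo E x (u k) y) ↔ pverts x ∈ LP E u W k := by
  constructor
  · rintro ⟨y, hy, h1, h2, h3⟩
    refine ⟨h1, by simp [pverts, h2], y, hy, ?_⟩
    rw [← h3]
    exact List.getLast?_eq_some_getLast (List.cons_ne_nil _ _)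
  · rintro ⟨h1, h2, y, hy, h3⟩
    refine ⟨y, hy, h1, by simpa [pverts] using h2, ?_⟩
    unfold pverts at h3
    rw [List.getLast?_eq_some_getLast (List.cons_ne_nil _ _)] at h3
    exact Option.some.inj h3

lemma path_end (E : V → V → Prop) (x : V × List V) (a y : V)
    (h1 : (pverts x).IsChain E) (h2 : (pverts x).head? = some a)
    (h3 : (pverts x).getLast? = some y) : PathFromTo E x a y := by
  refine ⟨h1, by simpa [pverts] using h2, ?_⟩
  unfold pverts at h3
  rw [List.getLast?_eq_some_getLast (List.cons_ne_nil _ _)] at h3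
  exact Option.some.inj h3

lemma not_inter (x y : V × List V) : ¬ Intersects x y ↔ List.Disjoint (pverts x) (pverts y) := by
  unfold Intersects List.Disjoint
  push Not
  exact ⟨fun h a ha hb => h a ha hb, fun h a ha hb => h ha hb⟩

lemma pverts_inj : Function.Injective (pverts : V × List V → List V) := by
  rintro ⟨a, l⟩ ⟨b, m⟩ h
  simpa [pverts] using h

lemma exists_pverts (E : V → V → Prop) (u : ℕ → V) (W : List V) (k : ℕ) (l : List V)
    (h : l ∈ LP E u W k) : ∃ x : V × List V, pverts x = l := by
  cases l with
  | nil => simp [LP] at h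
  | cons a l => exact ⟨(a, l), rfl⟩

lemma ANet_eq (E : V → V → Prop) (w : V → V → R) (u : ℕ → V) (W : List V)
    (P : ℕ → Finset (List V)) (hP : ∀ k l, l ∈ P k ↔ l ∈ LP E u W k) (i j : ℕ) :
    ANet E w u W i j = ∑ x ∈ P i, ∑ y ∈ P j,
      (lwt w x * lwt w y * ((if List.Disjoint x y then 1 else 0 : ℤ) : R)) := by
  have e1 : ∑ x ∈ P i, ∑ y ∈ P j,
      (lwt w x * lwt w y * ((if List.Disjoint x y then 1 else 0 : ℤ) : R)) =
      ∑ xy ∈ (P i ×ˢ P j).filter (fun xy => List.Disjoint xy.1 xy.2),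
        lwt w xy.1 * lwt w xy.2 := by
    rw [Finset.sum_filter, ← Finset.sum_product'
      (f := fun x y => lwt w x * lwt w y * ((if List.Disjoint x y then 1 else 0 : ℤ) : R))]
    apply Finset.sum_congr rfl
    intro xy _
    split_ifs <;> simp
  rw [e1, ← finsum_mem_coe_finset]
  unfold ANet
  apply finsum_mem_eq_of_bijOn (fun pq => (pverts pq.1, pverts pq.2))
  · refine ⟨?_, ?_, ?_⟩
    · rintro ⟨x, y⟩ ⟨h1, h2, h3⟩
      simp only [Finset.coe_filter, Finset.mem_product]
      exact ⟨⟨(hP _ _).2 ((path_LP E u W i x).1 h1), (hP _ _).2 ((path_LP E u W j y).1 h2)⟩,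
        (not_inter x y).1 h3⟩
    · rintro ⟨x, y⟩ _ ⟨x', y'⟩ _ h
      simp only [Prod.mk.injEq] at h
      rw [pverts_inj h.1, pverts_inj h.2]
    · rintro ⟨l, m⟩ h
      rw [Finset.mem_coe, Finset.mem_filter, Finset.mem_product, hP, hP] at h
      obtain ⟨⟨h1, h2⟩, h3⟩ := h
      simp only at h1 h2 h3
      obtain ⟨x, rfl⟩ := exists_pverts E u W i l h1
      obtain ⟨y, rfl⟩ := exists_pverts E u W j m h2
      exact ⟨(x, y), ⟨(path_LP E u W i x).2 h1, (path_LP E u W j y).2 h2, (not_inter x y).2 h3⟩, rfl⟩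
  · rintro ⟨x, y⟩ _
    rfl

def toTup (n : ℕ) (p : Fin (2 * n) → V × List V) (k : ℕ) : List V :=
  if h : 1 ≤ k ∧ k ≤ 2 * n then pverts (p ⟨k - 1, by omega⟩) else []

lemma toTup_succ (n : ℕ) (p : Fin (2 * n) → V × List V) (i : Fin (2 * n)) :
    toTup n p (i.1 + 1) = pverts (p i) := by
  unfold toTup
  rw [dif_pos (by omega)]
  rfl

lemma QI_eq (E : V → V → Prop) (w : V → V → R) (u : ℕ → V) (W : List V)
    (P : ℕ → Finset (List V)) (hP : ∀ k l, l ∈ P k ↔ l ∈ LP E u W k) (n : ℕ) (I : Finset ℕ)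
    (hI : I ⊆ Finset.Icc 1 (2 * n)) :
    QI E w u W n I = ∑ p ∈ (Tup P (Finset.Icc 1 (2 * n))).filter
      (fun p => NI I p ∧ NI (Finset.Icc 1 (2 * n) \ I) p),
        ∏ k ∈ Finset.Icc 1 (2 * n), lwt w (p k) := by
  have hN : ∀ k, k ∈ Finset.Icc 1 (2 * n) → ∃ i : Fin (2 * n), k = i.1 + 1 := by
    intro k hk
    rw [Finset.mem_Icc] at hk
    exact ⟨⟨k - 1, by omega⟩, by simp; omega⟩
  have hN' : ∀ i : Fin (2 * n), i.1 + 1 ∈ Finset.Icc 1 (2 * n) := by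
    intro i; rw [Finset.mem_Icc]; omega
  rw [← finsum_mem_coe_finset]
  unfold QI
  apply finsum_mem_eq_of_bijOn (toTup n)
  · refine ⟨?_, ?_, ?_⟩
    · rintro p ⟨h1, h2⟩
      rw [Finset.mem_coe, Finset.mem_filter, mem_Tup]
      refine ⟨⟨?_, ?_⟩, ?_, ?_⟩
      · intro k hk
        obtain ⟨i, rfl⟩ := hN k hk
        rw [toTup_succ, hP, ← path_LP]
        exact h1 i
      · intro k hk
        rw [Finset.mem_Icc] at hk
        unfold toTup
        rw [dif_neg hk]
      · intro a ha b hb hab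
        obtain ⟨i, rfl⟩ := hN a (hI ha)
        obtain ⟨j, rfl⟩ := hN b (hI hb)
        rw [toTup_succ, toTup_succ, ← not_inter]
        exact h2 i j (fun h => hab (by rw [h])) (by tauto)
      · intro a ha b hb hab
        rw [Finset.mem_sdiff] at ha hb
        obtain ⟨i, rfl⟩ := hN a ha.1
        obtain ⟨j, rfl⟩ := hN b hb.1
        rw [toTup_succ, toTup_succ, ← not_inter]
        exact h2 i j (fun h => hab (by rw [h])) (by tauto)
    · intro p _ q _ h
      funext i
      apply pverts_inj
      rw [← toTup_succ, ← toTup_succ, h]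
    · intro q hq
      rw [Finset.mem_coe, Finset.mem_filter, mem_Tup] at hq
      obtain ⟨⟨h1, h2⟩, h3, h4⟩ := hq
      have hex : ∀ i : Fin (2 * n), ∃ x : V × List V, pverts x = q (i.1 + 1) := fun i =>
        exists_pverts E u W (i.1 + 1) _ ((hP _ _).1 (h1 _ (hN' i)))
      choose p hp using hex
      refine ⟨p, ⟨?_, ?_⟩, ?_⟩
      · intro i
        rw [path_LP, hp, ← hP]
        exact h1 _ (hN' i)
      · intro i j hij hiff
        rw [not_inter, hp, hp]
        have hne : i.1 + 1 ≠ j.1 + 1 := fun h => hij (Fin.ext (by omega))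
        by_cases hi : i.1 + 1 ∈ I
        · exact h3 _ hi _ (hiff.1 hi) hne
        · exact h4 _ (Finset.mem_sdiff.2 ⟨hN' i, hi⟩) _
            (Finset.mem_sdiff.2 ⟨hN' j, fun h => hi (hiff.2 h)⟩) hne
      · funext k
        by_cases hk : k ∈ Finset.Icc 1 (2 * n)
        · obtain ⟨i, rfl⟩ := hN k hk
          rw [toTup_succ, hp]
        · rw [h2 k hk]
          rw [Finset.mem_Icc] at hk
          unfold toTup
          rw [dif_neg hk]
  · intro p _
    refine Finset.prod_bij (fun i _ => i.1 + 1) (fun i _ => hN' i) ?_ ?_ ?_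
    · intro i _ j _ h
      exact Fin.ext (by simpa using h)
    · intro k hk
      obtain ⟨i, rfl⟩ := hN k hk
      exact ⟨i, Finset.mem_univ _, rfl⟩
    · intro i _
      rw [toTup_succ]
      rfl

lemma pf_mul_expand (E : V → V → Prop) (w : V → V → R) (u : ℕ → V) (W : List V)
    (P : ℕ → Finset (List V)) (hP : ∀ k l, l ∈ P k ↔ l ∈ LP E u W k) (J K : Finset ℕ)
    (hd : Disjoint J K) :
    pfSub (ANet E w u W) J * pfSub (ANet E w u W) K =
      ∑ p ∈ Tup P (J ∪ K), (∏ k ∈ J ∪ K, lwt w (p k)) * ((pfSub (Bm p) J : ℤ) : R) *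
        ((pfSub (Bm p) K : ℤ) : R) := by
  have key : ∀ π ∈ PMs J, ∀ ρ ∈ PMs K,
      (∏ e ∈ π, ANet E w u W e.1 e.2) * (∏ e ∈ ρ, ANet E w u W e.1 e.2) =
      ∑ p ∈ Tup P (J ∪ K), (∏ k ∈ J ∪ K, lwt w (p k)) *
        ((∏ e ∈ π, (Bm p e.1 e.2 : R)) * (∏ e ∈ ρ, (Bm p e.1 e.2 : R))) := by
    intro π hπ ρ hρ
    rw [mem_PMs] at hπ hρ
    obtain ⟨h1, h2⟩ := pm_union J K hd π ρ hπ hρ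
    rw [← Finset.prod_union h1]
    simp_rw [ANet_eq E w u W P hP]
    rw [expand P (fun x y => lwt w x * lwt w y * ((if List.Disjoint x y then 1 else 0 : ℤ) : R))
      (π ∪ ρ) (J ∪ K) h2]
    apply Finset.sum_congr rfl
    intro p _
    rw [Finset.prod_mul_distrib, pm_prod (fun k => lwt w (p k)) (π ∪ ρ) (J ∪ K) h2,
      ← Finset.prod_union h1]
    rfl
  rw [pfSub_eq, pfSub_eq, Finset.sum_mul_sum]
  have step : ∀ p : ℕ → List V, (∏ k ∈ J ∪ K, lwt w (p k)) * ((pfSub (Bm p) J : ℤ) : R) *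
        ((pfSub (Bm p) K : ℤ) : R) = ∑ π ∈ PMs J, ∑ ρ ∈ PMs K, (msgn π : R) * (msgn ρ : R) *
        ((∏ k ∈ J ∪ K, lwt w (p k)) *
        ((∏ e ∈ π, (Bm p e.1 e.2 : R)) * (∏ e ∈ ρ, (Bm p e.1 e.2 : R)))) := by
    intro p
    rw [← pfSub_cast, ← pfSub_cast, pfSub_eq, pfSub_eq, mul_assoc, Finset.sum_mul_sum,
      Finset.mul_sum]
    apply Finset.sum_congr rfl
    intro π _
    rw [Finset.mul_sum]
    apply Finset.sum_congr rfl
    intro ρ _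
    ring
  simp_rw [step]
  conv_rhs => rw [Finset.sum_comm]
  apply Finset.sum_congr rfl
  intro π hπ
  conv_rhs => rw [Finset.sum_comm]
  apply Finset.sum_congr rfl
  intro ρ hρ
  rw [← Finset.mul_sum, ← key π hπ ρ hρ]
  ring

/-- For a network `N = (G,u,W)` on a finite acyclic digraph in which `u = (u_1,…,u_{2n})` is
`G`-compatible with the ordered vertex set `W`, and any `I ⊆ [2n]` of even cardinality,
`Q_I(N) = pf_{I,Ī}(A(N))`. -/
theorem QI_eq_pfPair [Fintype V] (E : V → V → Prop) (w : V → V → R) (n : ℕ)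
    (u : ℕ → V) (W : List V)
    (hacyclic : ∀ v : V, ¬Relation.TransGen E v v)
    (hcompat : ∀ i j : ℕ, 1 ≤ i → i < j → j ≤ 2 * n →
      ∀ a b : Fin W.length, (b : ℕ) < (a : ℕ) →
        ∀ p q : V × List V, PathFromTo E p (u i) (W.get a) →
          PathFromTo E q (u j) (W.get b) → Intersects p q)
    (I : Finset ℕ) (hI : I ⊆ Finset.Icc 1 (2 * n)) (heven : Even I.card) :
    QI E w u W n I =
      pfSub (ANet E w u W) I * pfSub (ANet E w u W) (Finset.Icc 1 (2 * n) \ I) := by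
  have hPex : ∃ P : ℕ → Finset (List V), ∀ k l, l ∈ P k ↔ l ∈ LP E u W k :=
    ⟨fun k => (LP_finite E hacyclic u W k).toFinset, fun k l => by simp⟩
  obtain ⟨P, hP⟩ := hPex
  have hc : LCompat E u W (Finset.Icc 1 (2 * n)) := by
    intro i hi j hj hij l hl m hm a b hba hla hmb hdis
    rw [Finset.mem_Icc] at hi hj
    obtain ⟨x, rfl⟩ := exists_pverts E u W i l hl
    obtain ⟨y, rfl⟩ := exists_pverts E u W j m hm
    exact (not_inter x y).2 hdis (hcompat i j hi.1 hij hj.2 a b hba x y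
      (path_end E x _ _ hl.1 hl.2.1 hla) (path_end E y _ _ hm.1 hm.2.1 hmb))
  have hd : Disjoint I (Finset.Icc 1 (2 * n) \ I) := Finset.disjoint_sdiff
  have hu : I ∪ (Finset.Icc 1 (2 * n) \ I) = Finset.Icc 1 (2 * n) :=
    Finset.union_sdiff_of_subset hI
  have hev' : Even (Finset.Icc 1 (2 * n) \ I).card := by
    rw [Finset.card_sdiff_of_subset hI, Nat.card_Icc]
    obtain ⟨m, hm⟩ := heven
    exact ⟨n - m, by omega⟩
  have hNI : ∀ (J : Finset ℕ) (p p' : ℕ → List V), (∀ k ∈ J, p k = p' k) → (NI J p ↔ NI J p') := by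
    intro J p p' h
    unfold NI
    constructor
    · intro hh a ha b hb hab
      rw [← h a ha, ← h b hb]; exact hh a ha b hb hab
    · intro hh a ha b hb hab
      rw [h a ha, h b hb]; exact hh a ha b hb hab
  rw [pf_mul_expand E w u W P hP I _ hd, hu, QI_eq E w u W P hP n I hI]
  rw [cancel E w hacyclic u W (Finset.Icc 1 (2 * n)) I P hP heven hI hc
    (fun p => ((pfSub (Bm p) (Finset.Icc 1 (2 * n) \ I) : ℤ) : R))]
  · have h2 := cancel E w hacyclic u W (Finset.Icc 1 (2 * n)) (Finset.Icc 1 (2 * n) \ I) P hP hev'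
      Finset.sdiff_subset hc (fun p => if NI I p then 1 else 0) (by
        intro p p' h
        have := hNI I p p' (fun k hk => h k (by simp [hk]))
        simp only [this])
    simp only [mul_right_comm _ (if NI I _ then (1 : R) else 0)] at h2 ⊢
    rw [h2, Finset.sum_filter]
    apply Finset.sum_congr rfl
    intro p _
    by_cases a1 : NI I p <;> by_cases a2 : NI (Finset.Icc 1 (2 * n) \ I) p <;> simp [a1, a2]
  · intro p p' h
    have : pfSub (Bm p) (Finset.Icc 1 (2 * n) \ I) = pfSub (Bm p') (Finset.Icc 1 (2 * n) \ I) := by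
      rw [pfSub_eq, pfSub_eq]
      apply Finset.sum_congr rfl
      intro π hπ
      rw [mem_PMs] at hπ
      congr 1
      apply Finset.prod_congr rfl
      intro e he
      obtain ⟨c1, c2, _⟩ := hπ.1 e he
      rw [Finset.mem_sdiff] at c1 c2
      unfold Bm
      rw [h _ c1.2, h _ c2.2]
    simp only [this]
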